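/- Let k, m ≥ 1, n = k + 2 + m, and let P be a Kazhdan–Lusztig family for S_n. Then P_{x_{k,2,m}, w_{k,2,m}} = 1 + q. -/

import Mathlib

open scoped Classical

namespace BSW

/-- The number of inversions (the length) of a permutation of `Fin n`. -/
def invLen {n : ℕ} (w : Equiv.Perm (Fin n)) : ℕ :=
  (Finset.univ.filter (fun p : Fin n × Fin n => p.1 < p.2 ∧ w p.2 < w p.1)).card

/-- The rank function `r_w(p,q) = #{i : 1 ≤ i ≤ p and w(i) ≥ q}`, where the
permutation of `Fin n` is regarded as a permutation of `{1,…,n}` (so position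
`i : Fin n` corresponds to `i+1` and value `w i` to `(w i)+1`). -/
def rank {n : ℕ} (w : Equiv.Perm (Fin n)) (p q : ℤ) : ℕ :=
  (Finset.univ.filter (fun i : Fin n =>
    ((i : ℕ) : ℤ) + 1 ≤ p ∧ q ≤ ((w i : ℕ) : ℤ) + 1)).card

/-- The difference function `d_{x,w}(p,q) = r_w(p,q) − r_x(p,q)`. -/
def dxw {n : ℕ} (x w : Equiv.Perm (Fin n)) (p q : ℤ) : ℤ :=
  (rank w p q : ℤ) - (rank x p q : ℤ)

/-- The Bruhat order: `x ≤ w` iff `d_{x,w}` is everywhere non-negative. -/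
def bruhatLE {n : ℕ} (x w : Equiv.Perm (Fin n)) : Prop :=
  ∀ p q : ℤ, 0 ≤ dxw x w p q

/-- The set of transpositions in `S_n`. -/
def transpositions (n : ℕ) : Set (Equiv.Perm (Fin n)) :=
  {t | ∃ a b : Fin n, a ≠ b ∧ t = Equiv.swap a b}

/-- `R(x,w) = {t ∈ T : l(xt) > l(x) and xt ≤ w}`. -/
def R {n : ℕ} (x w : Equiv.Perm (Fin n)) : Set (Equiv.Perm (Fin n)) :=
  {t | t ∈ transpositions n ∧ invLen x < invLen (x * t) ∧ bruhatLE (x * t) w}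

/-- `x` is a maximal singular point (MSP) for `w`. -/
def MSP {n : ℕ} (x w : Equiv.Perm (Fin n)) : Prop :=
  bruhatLE x w ∧ ((invLen w : ℤ) - (invLen x : ℤ) < ((R x w).ncard : ℤ)) ∧
    ∀ t ∈ R x w, ((R (x * t) w).ncard : ℤ) = (invLen w : ℤ) - (invLen (x * t) : ℤ)

/-- `Δ(x,w) = {i : t_{{i,j}} ∈ R(x,w) for some j}`. -/
def Delta {n : ℕ} (x w : Equiv.Perm (Fin n)) : Set (Fin n) :=
  {i | ∃ j : Fin n, Equiv.swap i j ∈ R x w}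

/-- `Δ(x,w)` as a finset. -/
noncomputable def DeltaFinset {n : ℕ} (x w : Equiv.Perm (Fin n)) : Finset (Fin n) :=
  (Set.toFinite (Delta x w)).toFinset

/-- `σ ∈ S_k` is the flattening of `x` along the increasing enumeration `d_1 < … < d_k`
of a set `D` of positions with `#D = k`: the unique permutation of `{1,…,k}` with
`σ(a) < σ(b)` iff `x(d_a) < x(d_b)`. -/
def IsFlatteningOn {n k : ℕ} (x : Equiv.Perm (Fin n)) (D : Finset (Fin n))
    (hD : D.card = k) (σ : Equiv.Perm (Fin k)) : Prop :=
  ∀ a b : Fin k, σ a < σ b ↔ x ((D.orderIsoOfFin hD a : Fin n)) < x ((D.orderIsoOfFin hD b : Fin n))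

/-- Values (0-indexed) of the permutation `x_{k,m} = [k,…,1, k+m,…,k+1]`. -/
def xkmVal (k m i : ℕ) : ℕ :=
  if i < k then k - 1 - i else 2 * k + m - 1 - i

/-- Values (0-indexed) of the permutation `w_{k,m} = [k+m, k,…,2, k+m−1,…,k+1, 1]`. -/
def wkmVal (k m i : ℕ) : ℕ :=
  if i = 0 then k + m - 1
  else if i < k then k - i
  else if i < k + m - 1 then 2 * k + m - 2 - i
  else 0

/-- Values (0-indexed) of the permutation `x_{k,l,m} = [k,…,1, k+l,…,k+1, k+l+m,…,k+l+1]`. -/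
def xklmVal (k l m i : ℕ) : ℕ :=
  if i < k then k - 1 - i
  else if i < k + l then 2 * k + l - 1 - i
  else 2 * (k + l) + m - 1 - i

/-- Values (0-indexed) of the permutation
`w_{k,l,m} = [k+l, k,…,2, k+l+m, k+l−1,…,k+2, 1, k+l+m−1,…,k+l+1, k+1]`. -/
def wklmVal (k l m i : ℕ) : ℕ :=
  if i = 0 then k + l - 1
  else if i < k then k - i
  else if i = k then k + l + m - 1
  else if i < k + l - 1 then 2 * k + l - 1 - i
  else if i = k + l - 1 then 0
  else if i < k + l + m - 1 then 2 * (k + l) + m - 2 - i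
  else k


/-- `μ(z,w)`: the coefficient of `q^{(l(w)−l(z)−1)/2}` in `P z w`, interpreted as `0`
when `l(w) − l(z)` is even. -/
noncomputable def klmu {n : ℕ}
    (P : Equiv.Perm (Fin n) → Equiv.Perm (Fin n) → Polynomial ℤ)
    (z w : Equiv.Perm (Fin n)) : ℤ :=
  if (invLen w - invLen z) % 2 = 1 then
    (P z w).coeff ((invLen w - invLen z - 1) / 2)
  else 0

/-- A Kazhdan–Lusztig family for `S_n`: a family of polynomials `P x w ∈ ℤ[q]`
(`q = Polynomial.X`) satisfying the defining properties of the Kazhdan–Lusztig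
polynomials: (1) `P x w = 0` unless `x ≤ w`; (2) `P x w = 1` if `x ≤ w` and
`l(w) − l(x) ≤ 2`; (3) `deg (P x w) ≤ (l(w) − l(x) − 1)/2` whenever `x ≤ w`; and
(4) the Kazhdan–Lusztig recurrence with respect to any simple transposition
`s = t_{a,a+1}` with `l(ws) < l(w)`. -/
structure KLFamily (n : ℕ) where
  P : Equiv.Perm (Fin n) → Equiv.Perm (Fin n) → Polynomial ℤ
  eq_zero : ∀ x w, ¬ bruhatLE x w → P x w = 0
  eq_one : ∀ x w, bruhatLE x w → invLen w ≤ invLen x + 2 → P x w = 1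
  deg_le : ∀ x w, bruhatLE x w → 2 * (P x w).natDegree ≤ invLen w - invLen x - 1
  recurrence : ∀ (x w : Equiv.Perm (Fin n)) (a b : Fin n), (b : ℕ) = (a : ℕ) + 1 →
    invLen (w * Equiv.swap a b) < invLen w →
    P x w =
      (if invLen (x * Equiv.swap a b) < invLen x then Polynomial.X else 1) *
          P x (w * Equiv.swap a b)
        + (if invLen (x * Equiv.swap a b) < invLen x then 1 else Polynomial.X) *
          P (x * Equiv.swap a b) (w * Equiv.swap a b)
        - ∑ z : Equiv.Perm (Fin n),
            if bruhatLE x z ∧ bruhatLE z (w * Equiv.swap a b) ∧ z ≠ w * Equiv.swap a b ∧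
                invLen (z * Equiv.swap a b) < invLen z then
              Polynomial.C (klmu P z (w * Equiv.swap a b)) *
                Polynomial.X ^ ((invLen w - invLen z) / 2) * P x z
            else 0

section Length

variable {n : ℕ}

theorem swap_adjacent_lt {a b i j : Fin n} (hab : (b : ℕ) = a + 1) (hij : i < j)
    (hne : ¬(i = a ∧ j = b)) : Equiv.swap a b i < Equiv.swap a b j := by
  simp only [Equiv.swap_apply_def]
  simp only [Fin.lt_def, Fin.ext_iff] at *
  split_ifs <;> omega

theorem invLen_mul_swap_of_lt (w : Equiv.Perm (Fin n)) {a b : Fin n} (hab : (b : ℕ) = a + 1)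
    (h : w a < w b) : invLen (w * Equiv.swap a b) = invLen w + 1 := by
  have hlt : a < b := by rw [Fin.lt_def]; omega
  have key : (Finset.univ.filter (fun p : Fin n × Fin n => p.1 < p.2 ∧
      (w * Equiv.swap a b) p.2 < (w * Equiv.swap a b) p.1)) =
      insert (a, b) ((Finset.univ.filter
        (fun p : Fin n × Fin n => p.1 < p.2 ∧ w p.2 < w p.1)).map
          ((Equiv.swap a b).prodCongr (Equiv.swap a b)).toEmbedding) := by
    ext ⟨i, j⟩
    simp only [Finset.mem_insert, Finset.mem_map_equiv, Finset.mem_filter, Finset.mem_univ,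
      true_and, Prod.mk.injEq, Equiv.prodCongr_symm, Equiv.symm_swap,
      Equiv.prodCongr_apply, Prod.map_apply]
    simp only [Equiv.Perm.mul_apply]
    constructor
    · rintro ⟨hij, hw⟩
      by_cases hne : i = a ∧ j = b
      · exact Or.inl hne
      · exact Or.inr ⟨swap_adjacent_lt hab hij hne, hw⟩
    · rintro (⟨rfl, rfl⟩ | ⟨hij, hw⟩)
      · simpa using ⟨hlt, h⟩
      · refine ⟨?_, hw⟩
        by_cases hne : Equiv.swap a b i = a ∧ Equiv.swap a b j = b
        · rw [hne.1, hne.2] at hw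
          exact absurd hw (not_lt.2 h.le)
        · simpa using swap_adjacent_lt hab hij hne
  unfold invLen
  rw [key, Finset.card_insert_of_notMem, Finset.card_map]
  simp [Finset.mem_map_equiv, hlt.le]

theorem invLen_mul_swap_of_gt (w : Equiv.Perm (Fin n)) {a b : Fin n} (hab : (b : ℕ) = a + 1)
    (h : w b < w a) : invLen w = invLen (w * Equiv.swap a b) + 1 := by
  have := invLen_mul_swap_of_lt (w * Equiv.swap a b) hab (by simpa using h)
  simpa [mul_assoc] using this

theorem invLen_mul_swap_lt_iff (w : Equiv.Perm (Fin n)) {a b : Fin n} (hab : (b : ℕ) = a + 1) :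
    invLen (w * Equiv.swap a b) < invLen w ↔ w b < w a := by
  have hne : w a ≠ w b := fun h => by
    have := w.injective h
    rw [this] at hab
    omega
  rcases lt_or_gt_of_ne hne with h | h
  · have := invLen_mul_swap_of_lt w hab h
    exact ⟨fun _ => by omega, fun h' => absurd h (not_lt.2 h'.le)⟩
  · have := invLen_mul_swap_of_gt w hab h
    exact ⟨fun _ => h, fun _ => by omega⟩

theorem invLen_inv (w : Equiv.Perm (Fin n)) : invLen w⁻¹ = invLen w := by
  unfold invLen
  refine Finset.card_bij' (fun p _ => (w⁻¹ p.2, w⁻¹ p.1)) (fun p _ => (w p.2, w p.1)) ?_ ?_ ?_ ?_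
  all_goals simp +contextual

theorem invLen_le (w : Equiv.Perm (Fin n)) : invLen w ≤ n * n := by
  unfold invLen
  exact (Finset.card_le_univ _).trans (by simp)

end Length

section Bruhat

variable {n : ℕ}

theorem bruhatLE_iff {x w : Equiv.Perm (Fin n)} :
    bruhatLE x w ↔ ∀ p q : ℤ, rank x p q ≤ rank w p q := by
  simp [bruhatLE, dxw]

theorem bruhatLE_refl (w : Equiv.Perm (Fin n)) : bruhatLE w w :=
  bruhatLE_iff.2 fun _ _ => le_rfl

theorem bruhatLE_trans {x y z : Equiv.Perm (Fin n)} (hxy : bruhatLE x y) (hyz : bruhatLE y z) :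
    bruhatLE x z :=
  bruhatLE_iff.2 fun p q => (bruhatLE_iff.1 hxy p q).trans (bruhatLE_iff.1 hyz p q)

theorem rank_succ (w : Equiv.Perm (Fin n)) (i : Fin n) (q : ℤ) :
    rank w ((i : ℕ) + 1) q = rank w (i : ℕ) q + if q ≤ ((w i : ℕ) : ℤ) + 1 then 1 else 0 := by
  unfold rank
  split_ifs with h
  · rw [← Finset.card_insert_of_notMem (a := i) (by simp)]
    congr 1
    ext j
    simp only [Finset.mem_insert, Finset.mem_filter, Finset.mem_univ, true_and]
    by_cases hj : j = i
    · subst hj; simp [h]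
    · have : (j : ℕ) ≠ i := fun h' => hj (Fin.ext h')
      simp only [hj, false_or]
      exact and_congr_left fun _ => by omega
  · rw [Nat.add_zero]
    congr 1
    ext j
    simp only [Finset.mem_filter, Finset.mem_univ, true_and]
    by_cases hj : j = i
    · subst hj; simp [h]
    · have : (j : ℕ) ≠ i := fun h' => hj (Fin.ext h')
      exact and_congr_left fun _ => by omega

theorem bruhatLE_antisymm {x w : Equiv.Perm (Fin n)} (h : bruhatLE x w) (h' : bruhatLE w x) :
    x = w := by
  have hr : ∀ p q : ℤ, rank x p q = rank w p q := fun p q =>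
    le_antisymm (bruhatLE_iff.1 h p q) (bruhatLE_iff.1 h' p q)
  ext i
  have hq : ∀ q : ℤ, q ≤ ((x i : ℕ) : ℤ) + 1 ↔ q ≤ ((w i : ℕ) : ℤ) + 1 := by
    intro q
    have h1 := hr ((i : ℕ) + 1) q
    rw [rank_succ, rank_succ, hr] at h1
    split_ifs at h1 <;> omega
  have h1 := (hq _).1 le_rfl
  have h2 := (hq _).2 le_rfl
  omega

theorem bruhatLE_mul_swap (w : Equiv.Perm (Fin n)) {a b : Fin n} (hab : a < b)
    (h : w b < w a) : bruhatLE (w * Equiv.swap a b) w := by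
  refine bruhatLE_iff.2 fun p q => ?_
  rw [Fin.lt_def] at hab h
  unfold rank
  by_cases hp : ((b : ℕ) : ℤ) + 1 ≤ p
  · refine Finset.card_le_card_of_injOn (Equiv.swap a b) ?_ (Equiv.swap a b).injective.injOn
    intro i
    simp only [Finset.coe_filter, Finset.mem_univ, true_and, Set.mem_ofPred_eq]
    rw [Equiv.Perm.mul_apply]
    refine fun hi => ⟨?_, hi.2⟩
    rw [Equiv.swap_apply_def]
    split_ifs <;> omega
  · refine Finset.card_le_card fun i => ?_
    simp only [Finset.mem_filter, Finset.mem_univ, true_and]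
    rw [Equiv.Perm.mul_apply]
    refine fun hi => ⟨hi.1, ?_⟩
    have hib : i ≠ b := fun hib => hp (hib ▸ hi.1)
    by_cases hia : i = a
    · subst hia
      have := hi.2
      rw [Equiv.swap_apply_left] at this
      omega
    · have := hi.2
      rwa [Equiv.swap_apply_of_ne_of_ne hia hib] at this

theorem wellFounded_bruhatLT :
    WellFounded fun x w : Equiv.Perm (Fin n) => bruhatLE x w ∧ x ≠ w := by
  have : IsTrans (Equiv.Perm (Fin n)) fun x w => bruhatLE x w ∧ x ≠ w :=
    ⟨fun x y z hxy hyz => ⟨bruhatLE_trans hxy.1 hyz.1, fun hxz =>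
      hxy.2 (bruhatLE_antisymm hxy.1 (hxz ▸ hyz.1))⟩⟩
  have : Std.Irrefl fun x w : Equiv.Perm (Fin n) => bruhatLE x w ∧ x ≠ w :=
    ⟨fun x h => h.2 rfl⟩
  exact Finite.wellFounded_of_trans_of_irrefl _

end Bruhat

section Descents

variable {n : ℕ} (F : KLFamily n)

/-- Kazhdan–Lusztig polynomials are invariant under a right descent of the upper element. -/
theorem KLFamily.P_mul_swap {a b : Fin n} (hab : (b : ℕ) = a + 1) (w : Equiv.Perm (Fin n))
    (hw : w b < w a) (x : Equiv.Perm (Fin n)) : F.P (x * Equiv.swap a b) w = F.P x w := by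
  have hlt : a < b := by rw [Fin.lt_def]; omega
  induction w using wellFounded_bruhatLT.induction generalizing x with
  | _ w ih =>
  have hws := (invLen_mul_swap_lt_iff w hab).2 hw
  have hle := bruhatLE_mul_swap w hlt hw
  rw [F.recurrence x w a b hab hws, F.recurrence (x * Equiv.swap a b) w a b hab hws]
  have hxx : x * Equiv.swap a b * Equiv.swap a b = x := by simp [mul_assoc]
  rw [hxx]
  congr 1
  · have hx : invLen (x * Equiv.swap a b) ≠ invLen x := by
      rcases lt_or_gt_of_ne (x.injective.ne hlt.ne) with h | h
      · have := invLen_mul_swap_of_lt x hab h; omega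
      · have := invLen_mul_swap_of_gt x hab h; omega
    rcases lt_or_gt_of_ne hx with h | h
    · rw [if_pos h, if_pos h, if_neg h.le.not_gt, if_neg h.le.not_gt]; ring
    · rw [if_pos h, if_pos h, if_neg h.le.not_gt, if_neg h.le.not_gt]; ring
  · refine Finset.sum_congr rfl fun z _ => ?_
    by_cases hz : bruhatLE z (w * Equiv.swap a b) ∧ z ≠ w * Equiv.swap a b ∧
        invLen (z * Equiv.swap a b) < invLen z
    · have hzw : z ≠ w := by
        rintro rfl
        exact hz.2.1 (bruhatLE_antisymm hz.1 hle)
      have hP := ih z ⟨bruhatLE_trans hz.1 hle, hzw⟩ ((invLen_mul_swap_lt_iff z hab).1 hz.2.2) x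
      rw [hP]
      simp only [hz.1, hz.2.1, hz.2.2, and_true, ne_eq, not_false_eq_true]
      split_ifs with h1 h2 h2
      · rfl
      · rw [F.eq_zero _ _ h2, mul_zero]
      · rw [← hP, F.eq_zero _ _ h1, mul_zero]
      · rfl
    · rw [if_neg fun h => hz h.2, if_neg fun h => hz h.2]

end Descents

section Blocks

variable {n : ℕ}

/-- The permutation `w` decreases on the block of positions `≤ k` and on the block of
positions `> k`. -/
def BlockDecreasing (k : ℕ) (w : Equiv.Perm (Fin n)) : Prop :=
  ∀ a b : Fin n, (b : ℕ) = a + 1 → (a : ℕ) ≠ k → w b < w a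

/-- The permutations `z` and `t` take the same values on the positions `≤ k`. -/
def SameBlocks (k : ℕ) (z t : Equiv.Perm (Fin n)) : Prop :=
  ∀ i : Fin n, (i : ℕ) ≤ k → (t.symm (z i) : ℕ) ≤ k

theorem BlockDecreasing.lt {k : ℕ} {w : Equiv.Perm (Fin n)} (hw : BlockDecreasing k w)
    {i j : Fin n} (hij : i < j) (hb : (i : ℕ) ≤ k ↔ (j : ℕ) ≤ k) : w j < w i := by
  obtain ⟨d, hd⟩ := Nat.exists_eq_add_of_lt hij
  induction d generalizing j with
  | zero => exact hw i j hd (by omega)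
  | succ d ih =>
    have hj := j.isLt
    have h1 := ih (j := ⟨i + d + 1, by omega⟩) (by simp [Fin.lt_def, add_assoc])
      (by simp only; omega) rfl
    exact (hw ⟨i + d + 1, by omega⟩ j (by simp only; omega) (by simp; omega)).trans h1

theorem SameBlocks.iff {k : ℕ} {z t : Equiv.Perm (Fin n)} (h : SameBlocks k z t) (i : Fin n) :
    (t.symm (z i) : ℕ) ≤ k ↔ (i : ℕ) ≤ k := by
  refine ⟨fun hi => ?_, h i⟩
  have himage : (Finset.univ.filter fun i : Fin n => (i : ℕ) ≤ k).image (fun i => t.symm (z i)) =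
      Finset.univ.filter fun i : Fin n => (i : ℕ) ≤ k := by
    refine Finset.eq_of_subset_of_card_le ?_ ?_
    · simpa [Finset.image_subset_iff, SameBlocks] using h
    · exact (Finset.card_image_of_injective _ (t.symm.injective.comp z.injective)).ge
  have hmem : t.symm (z i) ∈ Finset.univ.filter fun i : Fin n => (i : ℕ) ≤ k := by simpa using hi
  rw [← himage, Finset.mem_image] at hmem
  obtain ⟨j, hj, hji⟩ := hmem
  rw [z.injective (t.symm.injective hji)] at hj
  simpa using hj

theorem SameBlocks.eq {k : ℕ} {z t : Equiv.Perm (Fin n)} (h : SameBlocks k z t)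
    (hz : BlockDecreasing k z) (ht : BlockDecreasing k t) : z = t := by
  have hmono : StrictMono fun i => t.symm (z i) := by
    intro i j hij
    have hi := h.iff i
    have hj := h.iff j
    have hij' := Fin.lt_def.1 hij
    by_cases hb : (i : ℕ) ≤ k ↔ (j : ℕ) ≤ k
    · have h1 := hz.lt hij hb
      by_contra hcon
      have hne : t.symm (z j) ≠ t.symm (z i) :=
        fun h => hij.ne' (z.injective (t.symm.injective h))
      have h2 := ht.lt (lt_of_le_of_ne (not_lt.1 hcon) hne) (by rw [hi, hj, hb])
      simp only [Equiv.apply_symm_apply] at h2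
      exact h1.not_gt h2
    · simp only [Fin.lt_def]; omega
  have hid : (fun i => t.symm (z i)) = id := by
    refine (hmono.range_inj strictMono_id).1 ?_
    exact (t.symm.surjective.comp z.surjective).range_eq.trans Set.range_id.symm
  exact Equiv.ext fun i => t.symm_apply_eq.1 (congrFun hid i)

theorem SameBlocks.mul_swap {k : ℕ} {z t : Equiv.Perm (Fin n)} (h : SameBlocks k z t)
    {a b : Fin n} (hab : (b : ℕ) = a + 1) (ha : (a : ℕ) ≠ k) :
    SameBlocks k (z * Equiv.swap a b) t := by
  intro i hi
  refine h _ ?_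
  rw [Equiv.swap_apply_def]
  split_ifs with h1 h2 <;> subst_vars <;> omega

theorem SameBlocks.eq_or_exists_lt {k : ℕ} {z t : Equiv.Perm (Fin n)} (h : SameBlocks k z t)
    (ht : BlockDecreasing k t) :
    z = t ∨ ∃ a b : Fin n, (b : ℕ) = a + 1 ∧ (a : ℕ) ≠ k ∧ z a < z b := by
  by_contra! hcon
  refine hcon.1 (h.eq (fun a b hab ha => ?_) ht)
  refine lt_of_le_of_ne (hcon.2 a b hab ha) (z.injective.ne fun h => ?_)
  rw [h] at hab
  omega

theorem SameBlocks.invLen_le_and_P_eq {k : ℕ} {z t v : Equiv.Perm (Fin n)}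
    (h : SameBlocks k z t) (ht : BlockDecreasing k t) (hv : BlockDecreasing k v)
    (F : KLFamily n) : invLen z ≤ invLen t ∧ F.P z v = F.P t v := by
  obtain ⟨d, hd⟩ := Nat.exists_eq_add_of_le (invLen_le z)
  induction d using Nat.strong_induction_on generalizing z with
  | _ d ih =>
  rcases h.eq_or_exists_lt ht with rfl | ⟨a, b, hab, ha, hlt⟩
  · exact ⟨le_rfl, rfl⟩
  · have h1 := invLen_mul_swap_of_lt z hab hlt
    have h2 := invLen_le (z * Equiv.swap a b)
    obtain ⟨h3, h4⟩ := ih (d - 1) (by omega) (h.mul_swap hab ha) (by omega)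
    exact ⟨by omega, by rw [← h4, F.P_mul_swap hab v (hv a b hab ha)]⟩

/-- An element one step below the maximum of its coset still ascends between the two blocks. -/
theorem SameBlocks.lt_of_invLen {k : ℕ} {z t : Equiv.Perm (Fin n)}
    (h : SameBlocks k z t) (ht : BlockDecreasing k t) (F : KLFamily n)
    (hlen : invLen t ≤ invLen z + 1) {c d : Fin n} (hc : (c : ℕ) = k) (hd : (d : ℕ) = k + 1)
    (hmin : ∀ i, t c ≤ t i) (hmax : ∀ i, t i ≤ t d) : z c < z d := by
  have hcd : c ≠ d := fun h => by rw [h] at hc; omega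
  suffices hz : z c = t c ∨ z d = t d by
    refine lt_of_le_of_ne ?_ (z.injective.ne hcd)
    rcases hz with hz | hz
    · rw [hz]
      simpa using hmin (t.symm (z d))
    · rw [hz]
      simpa using hmax (t.symm (z c))
  rcases h.eq_or_exists_lt ht with rfl | ⟨a, b, hab, ha, hlt⟩
  · exact Or.inl rfl
  have h1 := invLen_mul_swap_of_lt z hab hlt
  rcases (h.mul_swap hab ha).eq_or_exists_lt ht with rfl | ⟨a', b', hab', ha', hlt'⟩
  · have hca : c ≠ a := fun h => ha (h ▸ hc)
    by_cases hcb : c = b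
    · subst hcb
      refine Or.inr ?_
      rw [Equiv.Perm.mul_apply, Equiv.swap_apply_of_ne_of_ne (fun h => ?_) hcd.symm]
      rw [h] at hd
      omega
    · exact Or.inl (by rw [Equiv.Perm.mul_apply, Equiv.swap_apply_of_ne_of_ne hca hcb])
  · have h2 := invLen_mul_swap_of_lt _ hab' hlt'
    have h3 := (((h.mul_swap hab ha).mul_swap hab' ha').invLen_le_and_P_eq ht ht F).1
    omega

end Blocks

/-- For `k, m ≥ 1` and any Kazhdan–Lusztig family `P` for `S_{k+2+m}`,
`P_{x_{k,2,m}, w_{k,2,m}} = 1 + q`. -/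
theorem kl_3412 (k m : ℕ) (hk : 1 ≤ k) (hm : 1 ≤ m) (F : KLFamily (k + 2 + m))
    (x w : Equiv.Perm (Fin (k + 2 + m)))
    (hx : ∀ i : Fin (k + 2 + m), (x i : ℕ) = xklmVal k 2 m (i : ℕ))
    (hw : ∀ i : Fin (k + 2 + m), (w i : ℕ) = wklmVal k 2 m (i : ℕ)) :
    F.P x w = 1 + Polynomial.X := by
  obtain ⟨c, hc⟩ : ∃ c : Fin (k + 2 + m), (c : ℕ) = k := ⟨⟨k, by omega⟩, rfl⟩
  obtain ⟨d, hd⟩ : ∃ d : Fin (k + 2 + m), (d : ℕ) = k + 1 := ⟨⟨k + 1, by omega⟩, rfl⟩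
  have hcd : (d : ℕ) = c + 1 := by omega
  have hcd' : c < d := by rw [Fin.lt_def]; omega
  obtain ⟨o, ho⟩ : ∃ o : Fin (k + 2 + m), (o : ℕ) = 0 := ⟨⟨0, by omega⟩, rfl⟩
  obtain ⟨e, he⟩ : ∃ e : Fin (k + 2 + m), (e : ℕ) = k + 1 + m := ⟨⟨k + 1 + m, by omega⟩, rfl⟩
  obtain ⟨v, hv⟩ : ∃ v, v = w * Equiv.swap c d := ⟨_, rfl⟩
  obtain ⟨u, hu⟩ : ∃ u, u = v * Equiv.swap o e := ⟨_, rfl⟩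
  have hvval : ∀ i : Fin (k + 2 + m), (v i : ℕ) =
      if (i : ℕ) = 0 then k + 1 else if (i : ℕ) ≤ k then k - i
      else if (i : ℕ) < k + 1 + m then 2 * k + 2 + m - i else k := by
    intro i
    have hi := i.isLt
    rw [hv, Equiv.Perm.mul_apply, hw, wklmVal, Equiv.swap_apply_def]
    simp only [Fin.ext_iff]
    split_ifs <;> omega
  have huval : ∀ i : Fin (k + 2 + m), (u i : ℕ) =
      if (i : ℕ) ≤ k then k - i else 2 * k + 2 + m - i := by
    intro i
    have hi := i.isLt
    rw [hu, Equiv.Perm.mul_apply, hvval, Equiv.swap_apply_def]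
    simp only [Fin.ext_iff]
    split_ifs <;> omega
  have hvdec : BlockDecreasing k v := by
    intro a b hab ha
    have hb := b.isLt
    rw [Fin.lt_def, hvval, hvval]
    split_ifs <;> omega
  have hudec : BlockDecreasing k u := by
    intro a b hab ha
    have hb := b.isLt
    rw [Fin.lt_def, huval, huval]
    split_ifs <;> omega
  have hsame_v : ∀ z : Equiv.Perm (Fin (k + 2 + m)),
      (∀ i : Fin (k + 2 + m), (i : ℕ) ≤ k → (z i : ℕ) < k ∨ (z i : ℕ) = k + 1) →
      SameBlocks k z v := by
    intro z hz i hi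
    have h := hvval (v.symm (z i))
    have := hz i hi
    have := (v.symm (z i)).isLt
    rw [Equiv.apply_symm_apply] at h
    split_ifs at h <;> omega
  have hsame_u : ∀ z : Equiv.Perm (Fin (k + 2 + m)),
      (∀ i : Fin (k + 2 + m), (i : ℕ) ≤ k → (z i : ℕ) ≤ k) → SameBlocks k z u := by
    intro z hz i hi
    have h := huval (u.symm (z i))
    have := hz i hi
    have := (u.symm (z i)).isLt
    rw [Equiv.apply_symm_apply] at h
    split_ifs at h <;> omega
  have huv : bruhatLE u v := by
    rw [hu]
    refine bruhatLE_mul_swap v (by rw [Fin.lt_def]; omega) ?_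
    rw [Fin.lt_def, hvval, hvval]
    split_ifs <;> omega
  have hlen : invLen v = invLen u + 1 := by
    have hve : (v e : ℕ) = k := by rw [hvval]; split_ifs <;> omega
    have hvo : (v o : ℕ) = k + 1 := by rw [hvval]; split_ifs; rfl
    have h := invLen_mul_swap_of_gt v⁻¹ (a := v e) (b := v o) (by omega)
      (by
        simpa using Fin.lt_def.2 (by omega : (o : ℕ) < e))
    have hinv : v⁻¹ * Equiv.swap (v e) (v o) = u⁻¹ := by
      rw [hu, Equiv.swap_apply_apply, mul_inv_rev, Equiv.swap_inv, Equiv.swap_comm]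
      group
    rwa [hinv, invLen_inv, invLen_inv] at h
  have hPv : F.P v v = 1 := F.eq_one v v (bruhatLE_refl v) (by omega)
  have hPu : F.P u v = 1 := F.eq_one u v huv (by omega)
  have hdesc : invLen (w * Equiv.swap c d) < invLen w := by
    rw [invLen_mul_swap_lt_iff w hcd, Fin.lt_def, hw, hw, wklmVal, wklmVal]
    split_ifs <;> omega
  have hxdesc : invLen (x * Equiv.swap c d) < invLen x := by
    rw [invLen_mul_swap_lt_iff x hcd, Fin.lt_def, hx, hx, xklmVal, xklmVal]
    split_ifs <;> omega
  have hxv : F.P x v = 1 := by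
    rw [← hPv]
    refine ((hsame_v x fun i hi => ?_).invLen_le_and_P_eq hvdec hvdec F).2
    rw [hx, xklmVal]
    split_ifs <;> omega
  have hxsv : F.P (x * Equiv.swap c d) v = 1 := by
    rw [← hPu]
    refine ((hsame_u _ fun i hi => ?_).invLen_le_and_P_eq hudec hvdec F).2
    rw [Equiv.Perm.mul_apply, hx, xklmVal, Equiv.swap_apply_def]
    simp only [Fin.ext_iff]
    split_ifs <;> omega
  have hclass : ∀ z, bruhatLE z v → SameBlocks k z v ∨ SameBlocks k z u := by
    intro z hz
    have hz' := bruhatLE_iff.1 hz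
    have h1 : ∀ i : Fin (k + 2 + m), (i : ℕ) ≤ k → (z i : ℕ) ≤ k + 1 := by
      intro i hi
      by_contra hcon
      have h0 : rank v (k + 1) (k + 3) = 0 := by
        unfold rank
        rw [Finset.card_eq_zero, Finset.filter_eq_empty_iff]
        intro j _ hj
        rw [hvval] at hj
        split_ifs at hj <;> omega
      have := hz' (k + 1) (k + 3)
      rw [h0, Nat.le_zero] at this
      unfold rank at this
      rw [Finset.card_eq_zero, Finset.filter_eq_empty_iff] at this
      exact this (Finset.mem_univ i) (by omega)
    have h2 : ∀ i j : Fin (k + 2 + m), (i : ℕ) ≤ k → (j : ℕ) ≤ k → k ≤ (z i : ℕ) →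
        k ≤ (z j : ℕ) → i = j := by
      intro i j hi hj hzi hzj
      have h0 : rank v (k + 1) (k + 1) ≤ 1 := by
        unfold rank
        rw [Finset.card_le_one]
        intro a ha b hb
        simp only [Finset.mem_filter, Finset.mem_univ, true_and, hvval] at ha hb
        rw [Fin.ext_iff]
        split_ifs at ha hb <;> omega
      have := (hz' (k + 1) (k + 1)).trans h0
      unfold rank at this
      rw [Finset.card_le_one] at this
      exact this i (by simp; omega) j (by simp; omega)
    by_cases h : ∃ j : Fin (k + 2 + m), (j : ℕ) ≤ k ∧ (z j : ℕ) = k + 1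
    · obtain ⟨j, hj, hzj⟩ := h
      refine Or.inl (hsame_v z fun i hi => ?_)
      by_contra! hcon
      have := h2 i j hi hj hcon.1 (by omega)
      exact hcon.2 (this ▸ hzj)
    · push Not at h
      refine Or.inr (hsame_u z fun i hi => ?_)
      have := h1 i hi
      have := h i hi
      omega
  have hmin : ∀ t : Equiv.Perm (Fin (k + 2 + m)), (t c : ℕ) = 0 → ∀ i, t c ≤ t i :=
    fun t ht i => by rw [Fin.le_def]; omega
  have hmax : ∀ t : Equiv.Perm (Fin (k + 2 + m)), (t d : ℕ) = k + 1 + m → ∀ i, t i ≤ t d :=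
    fun t ht i => by rw [Fin.le_def]; omega
  have hsum : ∀ z, bruhatLE z v → invLen (z * Equiv.swap c d) < invLen z → klmu F.P z v = 0 := by
    intro z hz hzd
    rw [invLen_mul_swap_lt_iff z hcd] at hzd
    unfold klmu
    obtain ⟨hP, hne⟩ : F.P z v = 1 ∧ ¬ invLen v ≤ invLen z + 1 := by
      rcases hclass z hz with h | h
      · refine ⟨(h.invLen_le_and_P_eq hvdec hvdec F).2.trans hPv, fun hl => hzd.not_gt ?_⟩
        refine h.lt_of_invLen hvdec F hl hc hd (hmin v ?_) (hmax v ?_)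
        all_goals rw [hvval]; split_ifs <;> omega
      · refine ⟨(h.invLen_le_and_P_eq hudec hvdec F).2.trans hPu, fun hl => hzd.not_gt ?_⟩
        refine h.lt_of_invLen hudec F (by omega) hc hd (hmin u ?_) (hmax u ?_)
        all_goals rw [huval]; split_ifs <;> omega
    split_ifs with hodd
    · rw [hP, Polynomial.coeff_one, if_neg (by omega)]
    · rfl
  rw [F.recurrence x w c d hcd hdesc, if_pos hxdesc, if_pos hxdesc, ← hv, hxv, hxsv,
    Finset.sum_eq_zero]
  · ring
  · intro z _
    split_ifs with h
    · rw [hsum z h.2.1 h.2.2.2]; simp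
    · rfl

end BSW
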